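/- Let (I_n)_{n≥3} be a family of functions I_n : ℕ^n → ℚ such that (i) each I_n is invariant under permutations of its n arguments; (ii) I_n(a_1,…,a_n) = 0 whenever a_1+⋯+a_n ≠ n−3; (iii) the string equation holds: for every n ≥ 3 and every (a_1,…,a_n) ∈ ℕ^n, I_{n+1}(a_1,…,a_n,0) = Σ_{j : a_j ≥ 1} I_n(a_1,…,a_{j−1}, a_j−1, a_{j+1},…,a_n); and (iv) I_3(0,0,0) = 1. Then for every n ≥ 3 and every (a_1,…,a_n) ∈ ℕ^n with a_1+⋯+a_n = n−3, one has I_n(a_1,…,a_n) = (n−3)!/(a_1!⋯a_n!). -/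

import Mathlib

theorem prod_factorial_update_pred {ι : Type*} [Fintype ι] [DecidableEq ι]
    (a : ι → ℕ) {j : ι} (hj : 1 ≤ a j) :
    a j * ∏ i, (Function.update a j (a j - 1) i).factorial = ∏ i, (a i).factorial := by
  rw [← Finset.mul_prod_erase _ _ (Finset.mem_univ j),
    ← Finset.mul_prod_erase (f := fun i => (a i).factorial) _ (Finset.mem_univ j),
    Function.update_self, ← mul_assoc, Nat.mul_factorial_pred (by omega)]
  congr 1
  refine Finset.prod_congr rfl fun i hi => ?_
  rw [Function.update_of_ne (Finset.ne_of_mem_erase hi)]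

theorem sum_update_pred_add_one {ι : Type*} [Fintype ι] [DecidableEq ι]
    (a : ι → ℕ) {j : ι} (hj : 1 ≤ a j) :
    ∑ i, Function.update a j (a j - 1) i + 1 = ∑ i, a i := by
  rw [Finset.sum_update_of_mem (Finset.mem_univ j), ← Finset.erase_eq,
    ← Finset.add_sum_erase _ a (Finset.mem_univ j)]
  omega

theorem exists_eq_zero_of_sum_lt {n : ℕ} (a : Fin n → ℕ) (h : ∑ i, a i < n) :
    ∃ i, a i = 0 := by
  by_contra! hne
  have hle : n ≤ ∑ i, a i := by
    simpa using Finset.card_nsmul_le_sum Finset.univ a 1 fun i _ =>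
      Nat.one_le_iff_ne_zero.2 (hne i)
  omega


/-- Genus-zero descendant integrals: from symmetry, the dimension constraint,
the string equation and the normalization `I 3 (0,0,0) = 1`, one deduces
`I n (a₁,…,aₙ) = (n-3)!/(a₁!⋯aₙ!)` whenever `a₁+⋯+aₙ = n-3`. -/
theorem stmt_0
    (I : (n : ℕ) → (Fin n → ℕ) → ℚ)
    (hsym : ∀ n, 3 ≤ n → ∀ (σ : Equiv.Perm (Fin n)) (a : Fin n → ℕ),
      I n (a ∘ σ) = I n a)
    (hvan : ∀ n, 3 ≤ n → ∀ a : Fin n → ℕ, (∑ i, a i) ≠ n - 3 → I n a = 0)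
    (hstring : ∀ n, 3 ≤ n → ∀ a : Fin n → ℕ,
      I (n + 1) (Fin.snoc a 0) =
        ∑ j : Fin n, if 1 ≤ a j then I n (Function.update a j (a j - 1)) else 0)
    (hinit : I 3 (fun _ => 0) = 1) :
    ∀ n, 3 ≤ n → ∀ a : Fin n → ℕ, (∑ i, a i) = n - 3 →
      I n a = (Nat.factorial (n - 3) : ℚ) / ∏ i, (Nat.factorial (a i) : ℚ) := by
  intro n hn
  induction n, hn using Nat.le_induction with
  | base =>
    intro a ha
    obtain rfl : a = fun _ => 0 := by
      funext i
      exact (Finset.sum_eq_zero_iff.1 ha) i (Finset.mem_univ i)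
    simp [hinit]
  | succ n hn ih =>
    intro a ha
    obtain ⟨i, hi⟩ := exists_eq_zero_of_sum_lt a (by omega)
    let σ := Equiv.swap i (Fin.last n)
    let b : Fin n → ℕ := Fin.init (a ∘ σ)
    have hb : (Fin.snoc b 0 : Fin (n + 1) → ℕ) = a ∘ σ := by
      have hlast : (a ∘ σ) (Fin.last n) = 0 := by simp [σ, hi]
      rw [← hlast]
      exact Fin.snoc_init_self _
    have hsum : ∑ j, b j = n - 2 := by
      have h : ∑ j, (Fin.snoc b 0 : Fin (n + 1) → ℕ) j = ∑ j, a j := by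
        rw [hb]
        exact Equiv.sum_comp σ a
      rw [ha, Fin.sum_univ_castSucc] at h
      simp only [Fin.snoc_castSucc, Fin.snoc_last] at h
      omega
    have hprod : ∏ j, ((a j).factorial : ℚ) = ∏ j, ((b j).factorial : ℚ) := by
      have h : ∏ j, (((Fin.snoc b 0 : Fin (n + 1) → ℕ) j).factorial : ℚ) =
          ∏ j, ((a j).factorial : ℚ) := by
        rw [hb]
        exact Equiv.prod_comp σ fun j => ((a j).factorial : ℚ)
      rw [← h]
      simp [Fin.prod_univ_castSucc]
    have hterm : ∀ j, (if 1 ≤ b j then I n (Function.update b j (b j - 1)) else 0) =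
        b j * (((n - 3).factorial : ℚ) / ∏ i, ((b i).factorial : ℚ)) := by
      intro j
      split_ifs with hj
      · have hs := sum_update_pred_add_one b hj
        rw [ih _ (by omega)]
        have hp : (b j : ℚ) * ∏ i, ((Function.update b j (b j - 1) i).factorial : ℚ) =
            ∏ i, ((b i).factorial : ℚ) := mod_cast prod_factorial_update_pred b hj
        have hj0 : (b j : ℚ) ≠ 0 := by
          exact_mod_cast Nat.one_le_iff_ne_zero.1 hj
        rw [← hp, ← mul_div_assoc, mul_div_mul_left _ _ hj0]
      · simp [Nat.lt_one_iff.1 (not_le.1 hj)]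
    have hfact : (n - 2) * (n - 3).factorial = (n + 1 - 3).factorial := by
      rw [show n + 1 - 3 = n - 3 + 1 by omega, Nat.factorial_succ]
      congr 1
      omega
    rw [← hsym (n + 1) (by omega) σ a, ← hb, hstring n hn, Finset.sum_congr rfl fun j _ => hterm j,
      ← Finset.sum_mul, ← Nat.cast_sum, hsum, hprod, ← mul_div_assoc, ← Nat.cast_mul, hfact]
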